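/- arXiv:1610.01583 — 3 statements merged into one kernel-verified Lean document; each statement's English description precedes it below -/
import Mathlib

section
/- Let f be a nonconstant meromorphic function on ℂ of order at most 1 such that f(s) → 1 as Re(s) → +∞ (uniformly in Im(s)). Then f ≡ ζ if and only if f satisfies the Riemann functional equation f(1 − s) = 2(2π)^{−s} cos(πs/2) Γ(s) f(s) and every zero of f is a zero of ζ with at least the same multiplicity. -/
open Complex Filter Topology

/-- `f` has a zero of exact order `m` at `z`. -/
def ZeroOfOrder (f : ℂ → ℂ) (z : ℂ) (m : ℕ) : Prop :=
  ∃ g : ℂ → ℂ, AnalyticAt ℂ g z ∧ g z ≠ 0 ∧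
    ∀ᶠ w in 𝓝[≠] z, f w = (w - z) ^ m * g w

/-- `f` has a pole of exact order `m` at `z`. -/
def PoleOfOrder (f : ℂ → ℂ) (z : ℂ) (m : ℕ) : Prop :=
  ∃ g : ℂ → ℂ, AnalyticAt ℂ g z ∧ g z ≠ 0 ∧
    ∀ᶠ w in 𝓝[≠] z, f w = g w / (w - z) ^ m

attribute [local instance] Classical.propDecidable

/-- The order of the pole of `f` at `z` (`0` if there is no pole). -/
noncomputable def poleOrd (f : ℂ → ℂ) (z : ℂ) : ℕ :=
  if h : ∃ m : ℕ, 0 < m ∧ PoleOfOrder f z m then h.choose else 0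

/-- `n(t, f)`: number of poles of `f`, counted with multiplicity, in the disc `|z| ≤ t`. -/
noncomputable def poleCount (f : ℂ → ℂ) (t : ℝ) : ℕ :=
  ∑ᶠ z ∈ {z : ℂ | ‖z‖ ≤ t}, poleOrd f z

/-- The Nevanlinna counting function `N(r, f)` of the poles of `f`. -/
noncomputable def nevN (f : ℂ → ℂ) (r : ℝ) : ℝ :=
  (∫ t in (0:ℝ)..r, ((poleCount f t : ℝ) - (poleCount f 0 : ℝ)) / t) +
    (poleCount f 0 : ℝ) * Real.log r

/-- The Nevanlinna proximity function `m(r, f)`. -/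
noncomputable def nevm (f : ℂ → ℂ) (r : ℝ) : ℝ :=
  (2 * Real.pi)⁻¹ *
    ∫ θ in (0:ℝ)..(2 * Real.pi), Real.log (max 1 ‖f (r * Complex.exp (θ * Complex.I))‖)

/-- The Nevanlinna characteristic `T(r, f) = m(r, f) + N(r, f)`. -/
noncomputable def nevT (f : ℂ → ℂ) (r : ℝ) : ℝ := nevm f r + nevN f r

/-- `f` has order at most `1`: `T(r, f) = O(r^{1+ε})` for every `ε > 0`. -/
def OrderLeOne (f : ℂ → ℂ) : Prop :=
  ∀ ε : ℝ, 0 < ε → ∃ C : ℝ, 0 < C ∧ ∀ r : ℝ, 1 ≤ r → nevT f r ≤ C * r ^ (1 + ε)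

/-- Equality of meromorphic functions (equality of germs off each point). -/
def MeroEq (f g : ℂ → ℂ) : Prop := ∀ z : ℂ, f =ᶠ[𝓝[≠] z] g

theorem norm_Gamma_le_Gamma_re {s : ℂ} (hs : 0 < s.re) : ‖Complex.Gamma s‖ ≤ Real.Gamma s.re := by
  rw [Complex.Gamma_eq_integral hs, Real.Gamma_eq_integral hs, Complex.GammaIntegral]
  refine (MeasureTheory.norm_integral_le_integral_norm _).trans (le_of_eq ?_)
  refine MeasureTheory.setIntegral_congr_fun measurableSet_Ioi fun x hx => ?_
  have hx : 0 < x := hx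
  simp only [norm_mul, ofReal_exp, ofReal_neg]
  rw [Complex.norm_cpow_eq_rpow_re_of_pos hx]
  simp [Complex.norm_exp]

theorem norm_mellin_le_of_re_mem_Icc {g : ℝ → ℂ} (hg : ∀ s : ℂ, MellinConvergent g s) (a b : ℝ) :
    ∃ K : ℝ, ∀ s : ℂ, s.re ∈ Set.Icc a b → ‖mellin g s‖ ≤ K := by
  have hint : ∀ c : ℝ, MeasureTheory.IntegrableOn (fun t : ℝ => t ^ (c - 1) * ‖g t‖) (Set.Ioi 0) := by
    intro c
    refine MeasureTheory.IntegrableOn.congr_fun (MeasureTheory.Integrable.norm (hg c))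
      (fun t ht => ?_) measurableSet_Ioi
    have ht : 0 < t := ht
    simp only [norm_smul]
    rw [Complex.norm_cpow_eq_rpow_re_of_pos ht]
    simp
  refine ⟨∫ t in Set.Ioi (0 : ℝ), (t ^ (a - 1) * ‖g t‖ + t ^ (b - 1) * ‖g t‖), fun s hs => ?_⟩
  rw [mellin]
  refine MeasureTheory.norm_integral_le_of_norm_le ((hint a).add (hint b)) ?_
  filter_upwards [MeasureTheory.ae_restrict_mem measurableSet_Ioi] with t ht
  have ht : 0 < t := ht
  rw [norm_smul, Complex.norm_cpow_eq_rpow_re_of_pos ht, ← add_mul]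
  gcongr
  simp only [sub_re, one_re]
  rcases le_total 1 t with h1 | h1
  · have := Real.rpow_le_rpow_of_exponent_le h1 (sub_le_sub_right hs.2 1)
    have := Real.rpow_nonneg ht.le (a - 1)
    linarith
  · have := Real.rpow_le_rpow_of_exponent_ge ht h1 (sub_le_sub_right hs.1 1)
    have := Real.rpow_nonneg ht.le (b - 1)
    linarith

theorem norm_completedRiemannZeta₀_le (a b : ℝ) :
    ∃ K : ℝ, ∀ s : ℂ, s.re ∈ Set.Icc a b → ‖completedRiemannZeta₀ s‖ ≤ K := by
  let P := HurwitzZeta.hurwitzEvenFEPair 0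
  have hconv : ∀ s : ℂ, MellinConvergent P.f_modif s := fun s =>
    let ⟨_, ht⟩ := exists_gt s.re
    let ⟨_, hu⟩ := exists_lt s.re
    mellinConvergent_of_isBigO_rpow P.hf_modif_int
      (P.isStrongFEPair_toStrongFEPair.hf_top _) ht (P.isStrongFEPair_toStrongFEPair.hf_zero _) hu
  obtain ⟨K, hK⟩ := norm_mellin_le_of_re_mem_Icc hconv (a / 2) (b / 2)
  refine ⟨K / 2, fun s hs => ?_⟩
  have : completedRiemannZeta₀ s = mellin P.f_modif (s / 2) / 2 := rfl
  rw [this, norm_div]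
  have h2 := hK (s / 2) (by
    have : (s / 2).re = s.re / 2 := by simp
    rw [this]; constructor <;> linarith [hs.1, hs.2])
  simp only [Complex.norm_ofNat]
  linarith

theorem norm_inv_Gammaℝ_le {s : ℂ} (hs : s.re < 2) :
    ‖(Gammaℝ s)⁻¹‖ ≤
      Real.pi ^ (s.re / 2) * (Real.Gamma (1 - s.re / 2) * Real.exp (Real.pi * ‖s‖ / 2)) := by
  have h1 : (Complex.Gamma (s / 2))⁻¹ =
      Complex.Gamma (1 - s / 2) * Complex.sin (Real.pi * (s / 2)) / Real.pi := by
    have h := Complex.Gamma_mul_Gamma_one_sub (s / 2)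
    have hne : Complex.Gamma (1 - s / 2) ≠ 0 := Complex.Gamma_ne_zero_of_re_pos (by simp; linarith)
    have hpi : (Real.pi : ℂ) ≠ 0 := by exact_mod_cast Real.pi_ne_zero
    by_cases h0 : Complex.sin (Real.pi * (s / 2)) = 0
    · rw [h0] at h ⊢
      simp only [div_zero, mul_eq_zero, hne, or_false] at h
      simp [h]
    · have hG : Complex.Gamma (s / 2) ≠ 0 := by
        intro h'
        rw [h', zero_mul] at h
        exact div_ne_zero hpi h0 h.symm
      rw [eq_div_iff h0] at h
      rw [eq_div_iff hpi, inv_mul_eq_iff_eq_mul₀ hG]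
      linear_combination -h
  have hsin : ‖Complex.sin (Real.pi * (s / 2))‖ ≤ Real.exp (Real.pi * ‖s‖ / 2) := by
    have e : ∀ z : ℂ, ‖Complex.sin z‖ ≤ Real.exp ‖z‖ := by
      intro z
      rw [Complex.sin]
      have a1 := Complex.norm_exp_le_exp_norm (-z * I)
      have a2 := Complex.norm_exp_le_exp_norm (z * I)
      simp only [norm_mul, norm_neg, norm_I, mul_one] at a1 a2
      calc ‖(Complex.exp (-z * I) - Complex.exp (z * I)) * I / 2‖
          = ‖Complex.exp (-z * I) - Complex.exp (z * I)‖ / 2 := by simp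
        _ ≤ (Real.exp ‖z‖ + Real.exp ‖z‖) / 2 := by
          gcongr; exact (norm_sub_le _ _).trans (add_le_add a1 a2)
        _ = _ := by ring
    refine (e _).trans (le_of_eq ?_)
    simp [abs_of_pos Real.pi_pos]; ring
  have hGam : ‖Complex.Gamma (1 - s / 2)‖ ≤ Real.Gamma (1 - s.re / 2) := by
    refine (norm_Gamma_le_Gamma_re (by simp; linarith)).trans (le_of_eq ?_)
    simp
  rw [Gammaℝ_def, mul_inv, h1, norm_mul, norm_inv, Complex.norm_cpow_eq_rpow_re_of_pos Real.pi_pos,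
    ← Real.rpow_neg Real.pi_pos.le]
  have : -((-s / 2).re) = s.re / 2 := by simp; ring
  rw [this, norm_div, norm_mul]
  gcongr
  have hp : ‖(Real.pi : ℂ)‖ = Real.pi := by simp [abs_of_pos Real.pi_pos]
  rw [hp]
  refine (div_le_self (by positivity) (by linarith [Real.pi_gt_three])).trans ?_
  exact mul_le_mul hGam hsin (norm_nonneg _) ((norm_nonneg _).trans hGam)

theorem norm_riemannZeta_le_of_three_halves_le_re {s : ℂ} (hs : 3 / 2 ≤ s.re) :
    ‖riemannZeta s‖ ≤ ∑' n : ℕ, 1 / (n : ℝ) ^ (3 / 2 : ℝ) := by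
  rw [zeta_eq_tsum_one_div_nat_cpow (by linarith)]
  refine tsum_of_norm_bounded (Real.summable_one_div_nat_rpow.mpr (by norm_num)).hasSum fun n => ?_
  rcases Nat.eq_zero_or_pos n with rfl | hn
  · have : s ≠ 0 := by rintro rfl; norm_num at hs
    simp [Complex.zero_cpow this]
  · rw [norm_div, norm_one, Complex.norm_natCast_cpow_of_pos hn]
    have : (1 : ℝ) ≤ n := by exact_mod_cast hn
    gcongr

theorem norm_riemannZeta_le_exp (A : ℝ) :
    ∃ C : ℝ, 0 ≤ C ∧ ∀ s : ℂ, |s.re| ≤ A → 2 ≤ ‖s‖ → ‖riemannZeta s‖ ≤ Real.exp (C * (1 + ‖s‖)) := by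
  obtain ⟨K, hK⟩ := norm_completedRiemannZeta₀_le (-A) A
  have hcont : ContinuousOn (fun x : ℝ => Real.pi ^ (x / 2) * Real.Gamma (1 - x / 2))
      (Set.Icc (-A) (3 / 2)) := by
    intro x hx
    refine ContinuousAt.continuousWithinAt ?_
    refine ContinuousAt.mul ?_ ?_
    · exact ContinuousAt.rpow continuousAt_const (by fun_prop) (Or.inl Real.pi_ne_zero)
    · refine ContinuousAt.comp (f := fun x : ℝ => 1 - x / 2) (g := Real.Gamma) ?_ (by fun_prop)
      refine (Real.differentiableAt_Gamma fun m => ?_).continuousAt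
      have := hx.2
      have : (0 : ℝ) ≤ m := m.cast_nonneg
      intro h
      linarith
  obtain ⟨L, hL⟩ := isCompact_Icc.exists_bound_of_continuousOn hcont
  set Z : ℝ := ∑' n : ℕ, 1 / (n : ℝ) ^ (3 / 2 : ℝ) with hZ
  have hexp : ∀ x : ℝ, x ≤ Real.exp |x| := fun x =>
    (le_abs_self x).trans ((by linarith : |x| ≤ |x| + 1).trans (Real.add_one_le_exp _))
  refine ⟨|Z| + |(|K| + 2) * L| + Real.pi, by positivity, fun s hs h2 => ?_⟩
  have hs' := abs_le.mp hs
  by_cases h : 3 / 2 ≤ s.re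
  · refine (norm_riemannZeta_le_of_three_halves_le_re h).trans ((hexp _).trans ?_)
    rw [Real.exp_le_exp]
    have : 0 ≤ |(|K| + 2) * L| + Real.pi := by positivity
    have : 0 ≤ |Z| := abs_nonneg _
    nlinarith
  · push Not at h
    have hs0 : s ≠ 0 := by rintro rfl; norm_num at h2
    rw [riemannZeta_def_of_ne_zero hs0, div_eq_mul_inv, norm_mul]
    have hL' : ‖completedRiemannZeta s‖ ≤ |K| + 2 := by
      rw [completedRiemannZeta_eq]
      have h1 : ‖1 / s‖ ≤ 1 := by
        rw [norm_div, norm_one]; exact div_le_one_of_le₀ (by linarith) (norm_nonneg _)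
      have h3 : 1 ≤ ‖1 - s‖ := by
        have := norm_sub_norm_le s 1
        rw [norm_sub_rev] at this
        simp only [norm_one] at this
        linarith
      have h4 : ‖1 / (1 - s)‖ ≤ 1 := by
        rw [norm_div, norm_one]; exact div_le_one_of_le₀ h3 (norm_nonneg _)
      have h5 := hK s hs'
      have h6 := norm_sub_le (completedRiemannZeta₀ s - 1 / s) (1 / (1 - s))
      have h7 := norm_sub_le (completedRiemannZeta₀ s) (1 / s)
      have := le_abs_self K
      linarith
    have hG := norm_inv_Gammaℝ_le (show s.re < 2 by linarith)
    have hLs := (le_abs_self _).trans (hL s.re ⟨hs'.1, h.le⟩)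
    calc ‖completedRiemannZeta s‖ * ‖(Gammaℝ s)⁻¹‖
        ≤ (|K| + 2) * (L * Real.exp (Real.pi * ‖s‖ / 2)) := by
          refine mul_le_mul hL' (hG.trans ?_) (norm_nonneg _) (by positivity)
          rw [← mul_assoc]
          gcongr
      _ = ((|K| + 2) * L) * Real.exp (Real.pi * ‖s‖ / 2) := by ring
      _ ≤ Real.exp |(|K| + 2) * L| * Real.exp (Real.pi * ‖s‖ / 2) := by
          gcongr; exact hexp _
      _ ≤ _ := by
          rw [← Real.exp_add, Real.exp_le_exp]
          have : 0 ≤ |(|K| + 2) * L| := abs_nonneg _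
          have : 0 ≤ |Z| := abs_nonneg _
          nlinarith [Real.pi_pos]

theorem tendsto_riemannZeta_comap_re_atTop :
    Tendsto riemannZeta (comap Complex.re atTop) (𝓝 1) := by
  have key : Tendsto (fun s : ℂ => ∑' n : ℕ, 1 / (n : ℂ) ^ s) (comap Complex.re atTop)
      (𝓝 (∑' n : ℕ, if n = 1 then (1 : ℂ) else 0)) := by
    refine tendsto_tsum_of_dominated_convergence (bound := fun n : ℕ => 1 / (n : ℝ) ^ (2 : ℝ))
      (Real.summable_one_div_nat_rpow.mpr (by norm_num)) (fun n => ?_) ?_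
    · rcases Nat.lt_trichotomy n 1 with hn | rfl | hn
      · obtain rfl : n = 0 := by omega
        simp only [Nat.cast_zero, zero_ne_one, if_false]
        refine tendsto_const_nhds.congr' ?_
        filter_upwards [preimage_mem_comap (Ioi_mem_atTop (0 : ℝ))] with s hs
        have hs : 0 < s.re := hs
        rw [Complex.zero_cpow (by rintro rfl; simp at hs)]; simp
      · simpa using (tendsto_const_nhds :
          Tendsto (fun _ : ℂ => (1 : ℂ)) (comap Complex.re atTop) (𝓝 1))
      · rw [if_neg (by omega)]
        rw [tendsto_zero_iff_norm_tendsto_zero]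
        have h1 : Tendsto (fun x : ℝ => ((n : ℝ)⁻¹) ^ x) atTop (𝓝 0) :=
          tendsto_rpow_atTop_of_base_lt_one _ (by
            have : (0:ℝ) < (n : ℝ)⁻¹ := by positivity
            linarith) (inv_lt_one_of_one_lt₀ (by exact_mod_cast hn))
        refine (h1.comp tendsto_comap).congr fun s => ?_
        simp only [Function.comp_apply]
        rw [norm_div, norm_one, Complex.norm_natCast_cpow_of_pos (by omega),
          Real.inv_rpow (by positivity), one_div]
    · filter_upwards [preimage_mem_comap (Ici_mem_atTop (2 : ℝ))] with s hs n
      have hs : 2 ≤ s.re := hs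
      rcases Nat.eq_zero_or_pos n with rfl | hn
      · have : s ≠ 0 := by rintro rfl; norm_num at hs
        simp [Complex.zero_cpow this]
      · rw [norm_div, norm_one, Complex.norm_natCast_cpow_of_pos hn]
        have : (1 : ℝ) ≤ n := by exact_mod_cast hn
        gcongr
  rw [tsum_ite_eq] at key
  refine key.congr' ?_
  filter_upwards [preimage_mem_comap (Ioi_mem_atTop (1 : ℝ))] with s hs
  exact (zeta_eq_tsum_one_div_nat_cpow hs).symm

theorem PoleOfOrder.meromorphicOrderAt_eq {f : ℂ → ℂ} {z : ℂ} {m : ℕ} (h : PoleOfOrder f z m)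
    (hf : MeromorphicAt f z) : meromorphicOrderAt f z = ((-(m : ℤ) : ℤ) : WithTop ℤ) := by
  obtain ⟨g, hg, hgz, he⟩ := h
  rw [meromorphicOrderAt_eq_int_iff hf]
  refine ⟨g, hg, hgz, he.mono fun w hw => ?_⟩
  rw [hw, zpow_neg, zpow_natCast, smul_eq_mul, div_eq_inv_mul]

theorem poleOrd_eq_negPart_divisor {f : ℂ → ℂ} (hf : Meromorphic f) (z : ℂ) :
    (poleOrd f z : ℤ) = (MeromorphicOn.divisor f Set.univ)⁻ z := by
  have hD : (MeromorphicOn.divisor f Set.univ)⁻ z = ((meromorphicOrderAt f z).untop₀)⁻ := by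
    rw [Function.locallyFinsuppWithin.negPart_apply,
      MeromorphicOn.divisor_apply hf.meromorphicOn (Set.mem_univ z)]
  rw [hD, poleOrd]
  split_ifs with h
  · have h2 := h.choose_spec.2.meromorphicOrderAt_eq (hf z)
    rw [h2]
    simp
  · by_cases ht : meromorphicOrderAt f z = ⊤
    · simp [ht]
    · lift meromorphicOrderAt f z to ℤ using ht with n hn
      simp only [WithTop.untop₀_coe, Nat.cast_zero]
      rw [eq_comm, negPart_eq_zero]
      by_contra hneg
      push Not at hneg
      refine h ⟨(-n).toNat, by omega, ?_⟩
      obtain ⟨g, hg, hgz, he⟩ := (meromorphicOrderAt_eq_int_iff (hf z)).mp hn.symm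
      refine ⟨g, hg, hgz, he.mono fun w hw => ?_⟩
      rw [hw, smul_eq_mul, div_eq_inv_mul, ← zpow_natCast, ← zpow_neg, Int.toNat_of_nonneg (by omega),
        neg_neg]

theorem integral_indicator_Ici_div {a r : ℝ} (ha : 0 < a) (har : a ≤ r) :
    IntervalIntegrable (fun t => (if a ≤ t then (1 : ℝ) else 0) / t) MeasureTheory.volume 0 r ∧
      ∫ t in (0 : ℝ)..r, (if a ≤ t then (1 : ℝ) else 0) / t = Real.log (r * a⁻¹) := by
  have h0 : (fun t => (if a ≤ t then (1 : ℝ) else 0) / t) =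
      (Set.Ici a).indicator (fun t => 1 / t) := by
    ext t
    by_cases h : a ≤ t <;> simp [h]
  have hr : 0 < r := ha.trans_le har
  have hset : Set.Ioc 0 r ∩ Set.Ici a = Set.Icc a r := by
    ext t; simp only [Set.mem_inter_iff, Set.mem_Ioc, Set.mem_Ici, Set.mem_Icc]
    constructor
    · rintro ⟨⟨_, h⟩, h'⟩; exact ⟨h', h⟩
    · rintro ⟨h, h'⟩; exact ⟨⟨ha.trans_le h, h'⟩, h⟩
  have hint : IntervalIntegrable (fun t : ℝ => 1 / t) MeasureTheory.volume a r := by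
    refine intervalIntegral.intervalIntegrable_one_div (fun x hx => ?_) continuousOn_id
    rw [Set.uIcc_of_le har] at hx
    exact (ha.trans_le hx.1).ne'
  rw [h0]
  constructor
  · rw [intervalIntegrable_iff_integrableOn_Ioc_of_le hr.le, MeasureTheory.IntegrableOn,
      MeasureTheory.integrable_indicator_iff measurableSet_Ici, MeasureTheory.IntegrableOn,
      MeasureTheory.Measure.restrict_restrict measurableSet_Ici, Set.inter_comm, hset]
    rwa [intervalIntegrable_iff_integrableOn_Icc_of_le har] at hint
  · rw [intervalIntegral.integral_of_le hr.le,
      MeasureTheory.setIntegral_indicator measurableSet_Ici, hset,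
      MeasureTheory.integral_Icc_eq_integral_Ioc, ← intervalIntegral.integral_of_le har,
      integral_one_div_of_pos ha hr, div_eq_mul_inv]

theorem nevN_eq_logCounting {f : ℂ → ℂ} (hf : Meromorphic f) {r : ℝ} (hr : 0 < r) :
    nevN f r = ValueDistribution.logCounting f ⊤ r := by
  set D := (MeromorphicOn.divisor f Set.univ)⁻ with hD
  have hfin := (D.toClosedBall r).finiteSupport (isCompact_closedBall 0 |r|)
  set S := hfin.toFinset with hS
  have hmem : ∀ z, ‖z‖ ≤ r → poleOrd f z ≠ 0 → z ∈ S := by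
    intro z hz h
    rw [hS, Set.Finite.mem_toFinset, Function.mem_support,
      Function.locallyFinsuppWithin.toClosedBall_eval_within _ (by simpa [abs_of_pos hr] using hz)]
    rw [hD, ← poleOrd_eq_negPart_divisor hf]
    exact_mod_cast h
  have hmem' : ∀ z ∈ S, ‖z‖ ≤ r := by
    intro z hz
    have := Function.locallyFinsuppWithin.toClosedBall_support_subset_closedBall D
      (hfin.mem_toFinset.mp hz)
    simpa [abs_of_pos hr] using this
  have hcount : ∀ t ≤ r, poleCount f t = ∑ z ∈ S, if ‖z‖ ≤ t then poleOrd f z else 0 := by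
    intro t ht
    rw [poleCount, finsum_mem_def, finsum_eq_sum_of_support_subset]
    · exact Finset.sum_congr rfl fun z _ => by simp [Set.indicator_apply]
    · intro z hz
      simp only [Function.mem_support, Set.indicator_apply, Set.mem_ofPred_eq] at hz
      split_ifs at hz with h
      · exact hmem z (h.trans ht) hz
      · exact absurd rfl hz
  have h0 : poleCount f 0 = poleOrd f 0 := by
    rw [poleCount]
    have : {z : ℂ | ‖z‖ ≤ 0} = {0} := by ext z; simp
    rw [this, finsum_mem_singleton]
  have hdiff : ∀ t ∈ Set.Icc 0 r, ((poleCount f t : ℝ) - (poleCount f 0 : ℝ)) / t =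
      ∑ z ∈ S.erase 0, (poleOrd f z : ℝ) * ((if ‖z‖ ≤ t then (1 : ℝ) else 0) / t) := by
    intro t ht
    have : (poleCount f t : ℝ) - poleCount f 0 =
        ∑ z ∈ S.erase 0, (poleOrd f z : ℝ) * (if ‖z‖ ≤ t then (1 : ℝ) else 0) := by
      rw [hcount t ht.2, h0]
      push_cast
      by_cases hz : (0 : ℂ) ∈ S
      · rw [← Finset.add_sum_erase S _ hz]
        simp [ht.1]
      · rw [Finset.erase_eq_of_notMem hz]
        have : poleOrd f 0 = 0 := by
          by_contra h
          exact hz (hmem 0 (by simpa using hr.le) h)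
        simp [this]
    rw [this, Finset.sum_div]
    exact Finset.sum_congr rfl fun z _ => by ring
  have hpos : ∀ z ∈ S.erase 0, 0 < ‖z‖ ∧ ‖z‖ ≤ r := fun z hz =>
    ⟨norm_pos_iff.mpr (Finset.ne_of_mem_erase hz), hmem' z (Finset.mem_of_mem_erase hz)⟩
  have hL : ValueDistribution.logCounting f ⊤ r =
      ∑ᶠ z, D.toClosedBall r z * Real.log (r * ‖z‖⁻¹) + D 0 * Real.log r := by
    rw [ValueDistribution.logCounting_top]; rfl
  rw [nevN, hL]
  have hDo : ∀ z, ((D z : ℤ) : ℝ) = poleOrd f z := fun z => by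
    rw [hD, ← poleOrd_eq_negPart_divisor hf]; simp
  rw [hDo, ← h0]
  congr 1
  rw [intervalIntegral.integral_congr (g := fun t => ∑ z ∈ S.erase 0,
      (poleOrd f z : ℝ) * ((if ‖z‖ ≤ t then (1 : ℝ) else 0) / t))
      (fun t ht => hdiff t (by rwa [Set.uIcc_of_le hr.le] at ht)),
    intervalIntegral.integral_finsetSum fun z hz =>
      (integral_indicator_Ici_div (hpos z hz).1 (hpos z hz).2).1.const_mul _]
  rw [finsum_eq_sum_of_support_subset (s := S)]
  · rw [← Finset.sum_erase (a := (0 : ℂ)) S (by simp)]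
    refine Finset.sum_congr rfl fun z hz => ?_
    rw [intervalIntegral.integral_const_mul,
      (integral_indicator_Ici_div (hpos z hz).1 (hpos z hz).2).2,
      Function.locallyFinsuppWithin.toClosedBall_eval_within _
        (by simpa [abs_of_pos hr] using (hpos z hz).2), hDo]
  · intro z hz
    simp only [Function.mem_support] at hz
    rw [hS, Set.Finite.coe_toFinset, Function.mem_support]
    intro h
    rw [h] at hz
    simp at hz

theorem nevm_eq_proximity (f : ℂ → ℂ) (r : ℝ) :
    nevm f r = ValueDistribution.proximity f ⊤ r := by
  rw [ValueDistribution.proximity_top, nevm, Real.circleAverage_def, smul_eq_mul]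
  congr 1
  refine intervalIntegral.integral_congr fun θ _ => ?_
  simp only [circleMap_zero]
  exact (Real.posLog_eq_log_max_one (norm_nonneg _)).symm

theorem nevT_eq_characteristic {f : ℂ → ℂ} (hf : Meromorphic f) {r : ℝ} (hr : 0 < r) :
    nevT f r = ValueDistribution.characteristic f ⊤ r := by
  rw [nevT, nevm_eq_proximity, nevN_eq_logCounting hf hr]; rfl

theorem AnalyticOnNhd.log_norm_le_circleAverage_log_norm {g : ℂ → ℂ} {c : ℂ} {R : ℝ} (hR : 0 < R)
    (hg : AnalyticOnNhd ℂ g (Metric.closedBall c |R|)) (hc : g c ≠ 0) :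
    Real.log ‖g c‖ ≤ Real.circleAverage (fun z => Real.log ‖g z‖) c R := by
  rw [AnalyticOnNhd.circleAverage_log_norm hR.ne' hg hc]
  refine le_add_of_nonneg_left (finsum_nonneg fun u => ?_)
  by_cases hu : u ∈ Metric.closedBall c |R|
  · refine mul_nonneg (by exact_mod_cast (MeromorphicOn.AnalyticOnNhd.divisor_nonneg hg) u) ?_
    by_cases h0 : ‖c - u‖ = 0
    · simp [h0]
    · refine Real.log_nonneg ?_
      rw [Metric.mem_closedBall, dist_comm, dist_eq_norm, abs_of_pos hR] at hu
      have : 0 < ‖c - u‖ := lt_of_le_of_ne (norm_nonneg _) (Ne.symm h0)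
      rw [← div_eq_mul_inv, le_div_iff₀ this]
      linarith
  · rw [Function.locallyFinsuppWithin.apply_eq_zero_of_notMem _ hu]
    simp

theorem setIntegral_ball_zero_eq_integral_circleAverage {u : ℂ → ℝ} (hu : Continuous u) {r : ℝ}
    (hr : 0 ≤ r) :
    ∫ z in Metric.ball (0 : ℂ) r, u z =
      ∫ ρ in (0 : ℝ)..r, 2 * Real.pi * ρ * Real.circleAverage u 0 ρ := by
  rw [← MeasureTheory.integral_indicator measurableSet_ball,
    ← Complex.integral_comp_polarCoord_symm]
  have h1 : Set.EqOn (fun p : ℝ × ℝ => p.1 • (Metric.ball (0 : ℂ) r).indicator u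
        (Complex.polarCoord.symm p))
      ((Set.Iio r ×ˢ Set.univ).indicator fun p : ℝ × ℝ => p.1 * u (circleMap 0 p.1 p.2))
      polarCoord.target := by
    rintro ⟨ρ, θ⟩ hp
    rw [polarCoord_target] at hp
    have hρ : 0 < ρ := hp.1
    have he : Complex.polarCoord.symm (ρ, θ) = circleMap 0 ρ θ := by
      rw [Complex.polarCoord_symm_apply, circleMap_zero, Complex.exp_mul_I]
      push_cast
      rfl
    have hn : ‖circleMap 0 ρ θ‖ = ρ := by simp [abs_of_pos hρ]
    have hmem : circleMap 0 ρ θ ∈ Metric.ball (0 : ℂ) r ↔ ρ < r := by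
      rw [mem_ball_zero_iff, hn]
    change ρ • (Metric.ball (0 : ℂ) r).indicator u (Complex.polarCoord.symm (ρ, θ)) =
      (Set.Iio r ×ˢ Set.univ).indicator (fun p : ℝ × ℝ => p.1 * u (circleMap 0 p.1 p.2)) (ρ, θ)
    by_cases hlt : ρ < r
    · rw [he, Set.indicator_of_mem (hmem.mpr hlt),
        Set.indicator_of_mem (show (ρ, θ) ∈ Set.Iio r ×ˢ Set.univ from ⟨hlt, trivial⟩), smul_eq_mul]
    · rw [he, Set.indicator_of_notMem (fun h => hlt (hmem.mp h)),
        Set.indicator_of_notMem (fun h => hlt h.1), smul_zero]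
  rw [MeasureTheory.setIntegral_congr_fun polarCoord.open_target.measurableSet h1,
    MeasureTheory.setIntegral_indicator (measurableSet_Iio.prod MeasurableSet.univ),
    polarCoord_target, Set.prod_inter_prod, Set.inter_univ, Set.Ioi_inter_Iio]
  have hcont : Continuous fun p : ℝ × ℝ => p.1 * u (circleMap 0 p.1 p.2) := by
    simp only [circleMap]
    fun_prop
  rw [MeasureTheory.Measure.volume_eq_prod, MeasureTheory.setIntegral_prod]
  · rw [← MeasureTheory.integral_Ioc_eq_integral_Ioo, ← intervalIntegral.integral_of_le hr]
    refine intervalIntegral.integral_congr fun ρ _ => ?_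
    simp only
    rw [MeasureTheory.integral_const_mul, ← MeasureTheory.integral_Ioc_eq_integral_Ioo,
      ← intervalIntegral.integral_of_le (by linarith [Real.pi_pos]), Real.circleAverage_def]
    have hper : Function.Periodic (fun θ => u (circleMap 0 ρ θ)) (2 * Real.pi) := fun θ => by
      simp only [periodic_circleMap 0 ρ θ]
    have h2 := hper.intervalIntegral_add_eq (-Real.pi) 0
    rw [show -Real.pi + 2 * Real.pi = Real.pi by ring, zero_add] at h2
    rw [h2, smul_eq_mul]
    have := Real.pi_pos
    field_simp
  · refine (hcont.continuousOn.integrableOn_compact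
      (isCompact_Icc.prod isCompact_Icc : IsCompact (Set.Icc 0 r ×ˢ Set.Icc (-Real.pi) Real.pi))).mono_set ?_
    exact Set.prod_mono Set.Ioo_subset_Icc_self Set.Ioo_subset_Icc_self

theorem setIntegral_ball_eq_integral_circleAverage {u : ℂ → ℝ} (hu : Continuous u) (c : ℂ) {r : ℝ}
    (hr : 0 ≤ r) :
    ∫ z in Metric.ball c r, u z =
      ∫ ρ in (0 : ℝ)..r, 2 * Real.pi * ρ * Real.circleAverage u c ρ := by
  have h := setIntegral_ball_zero_eq_integral_circleAverage (u := fun z => u (z + c))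
    (by fun_prop) hr
  simp only [Real.circleAverage_map_add_const] at h
  rw [← h]
  have hmp := MeasureTheory.measurePreserving_add_right (MeasureTheory.volume : MeasureTheory.Measure ℂ) c
  have h2 := hmp.setIntegral_preimage_emb (measurableEmbedding_addRight c) u (Metric.ball c r)
  rw [← h2]
  congr 2
  ext z
  simp [dist_eq_norm]

theorem Differentiable.posLog_norm_le_of_circleAverage_le {g : ℂ → ℂ} (hg : Differentiable ℂ g)
    {M : ℝ} (z : ℂ)
    (hM : ∀ ρ ∈ Set.Ioc 0 (‖z‖ + 1), Real.circleAverage (fun w => Real.posLog ‖g w‖) 0 ρ ≤ M) :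
    Real.posLog ‖g z‖ ≤ (‖z‖ + 1) ^ 2 * M := by
  have hu : Continuous fun w => Real.posLog ‖g w‖ :=
    Real.continuous_posLog.comp hg.continuous.norm
  have hle : ∀ ρ : ℝ, 0 < ρ →
      Real.posLog ‖g z‖ ≤ Real.circleAverage (fun w => Real.posLog ‖g w‖) z ρ := by
    intro ρ hρ
    rcases le_or_gt ‖g z‖ 1 with h1 | h1
    · rw [(Real.posLog_eq_zero_iff _).mpr (by simpa using h1)]
      exact Real.circleAverage_nonneg_of_nonneg fun w _ => Real.posLog_nonneg
    · have han : AnalyticOnNhd ℂ g (Metric.closedBall z |ρ|) := fun w _ => hg.analyticAt w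
      have hz : g z ≠ 0 := by
        intro h
        rw [h] at h1
        norm_num at h1
      rw [Real.posLog_eq_log (by simpa using h1.le)]
      refine (han.log_norm_le_circleAverage_log_norm hρ hz).trans ?_
      refine Real.circleAverage_mono ?_ ?_ fun w _ => le_max_right _ _
      · exact MeromorphicOn.circleIntegrable_log_norm
          (fun w hw => (hg.analyticAt w).meromorphicAt)
      · exact hu.continuousOn.circleIntegrable'
  have h1 : ∫ ρ in (0 : ℝ)..1, 2 * Real.pi * ρ * Real.posLog ‖g z‖ ≤
      ∫ w in Metric.ball z 1, Real.posLog ‖g w‖ := by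
    rw [setIntegral_ball_eq_integral_circleAverage hu z zero_le_one]
    refine intervalIntegral.integral_mono_on zero_le_one
      (Continuous.intervalIntegrable (by fun_prop) _ _)
      (Continuous.intervalIntegrable (((by fun_prop : Continuous fun ρ : ℝ => 2 * Real.pi * ρ)).mul
        (Real.Continuous.circleAverage (c := z) hu)) _ _) fun ρ hρ => ?_
    rcases hρ.1.eq_or_lt with h0 | h0
    · simp [← h0]
    · have := Real.pi_pos
      exact mul_le_mul_of_nonneg_left (hle ρ h0) (by positivity)
  have h2 : ∫ w in Metric.ball z 1, Real.posLog ‖g w‖ ≤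
      ∫ w in Metric.ball (0 : ℂ) (‖z‖ + 1), Real.posLog ‖g w‖ := by
    refine MeasureTheory.setIntegral_mono_set ?_ ?_ ?_
    · exact (hu.continuousOn.integrableOn_compact (isCompact_closedBall 0 (‖z‖ + 1))).mono_set
        Metric.ball_subset_closedBall
    · exact MeasureTheory.ae_of_all _ fun w => Real.posLog_nonneg
    · exact (Metric.ball_subset_ball' (by simp [add_comm])).eventuallyLE
  have h3 : ∫ w in Metric.ball (0 : ℂ) (‖z‖ + 1), Real.posLog ‖g w‖ ≤
      ∫ ρ in (0 : ℝ)..(‖z‖ + 1), 2 * Real.pi * ρ * M := by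
    have hz : 0 ≤ ‖z‖ + 1 := by positivity
    rw [setIntegral_ball_eq_integral_circleAverage hu 0 hz]
    refine intervalIntegral.integral_mono_on hz
      (Continuous.intervalIntegrable (((by fun_prop : Continuous fun ρ : ℝ => 2 * Real.pi * ρ)).mul
        (Real.Continuous.circleAverage (c := 0) hu)) _ _)
      (Continuous.intervalIntegrable (by fun_prop) _ _) fun ρ hρ => ?_
    rcases hρ.1.eq_or_lt with h0 | h0
    · simp [← h0]
    · have := Real.pi_pos
      exact mul_le_mul_of_nonneg_left (hM ρ ⟨h0, hρ.2⟩) (by positivity)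
  have hI : ∀ a b : ℝ, ∫ ρ in (0 : ℝ)..a, 2 * Real.pi * ρ * b = Real.pi * (a ^ 2 * b) := by
    intro a b
    rw [intervalIntegral.integral_mul_const, intervalIntegral.integral_const_mul, integral_id]
    ring
  rw [hI] at h1 h3
  have := (h1.trans h2).trans h3
  have := le_of_mul_le_mul_left this Real.pi_pos
  linarith

theorem Differentiable.apply_eq_apply_of_bounded_off_strip {h : ℂ → ℂ} (hd : Differentiable ℂ h)
    {a b K C : ℝ} {n : ℕ} (hab : a < b) (hg : ∀ z, Real.posLog ‖h z‖ ≤ C * (1 + ‖z‖) ^ n)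
    (ha : ∀ z : ℂ, z.re ≤ a → ‖h z‖ ≤ K) (hb : ∀ z : ℂ, b ≤ z.re → ‖h z‖ ≤ K) (z w : ℂ) :
    h z = h w := by
  refine hd.apply_eq_apply_of_bounded (isBounded_iff_forall_norm_le.mpr ⟨K, ?_⟩) z w
  rintro _ ⟨z, rfl⟩
  rcases le_total z.re a with h1 | h1
  · exact ha z h1
  rcases le_total b z.re with h2 | h2
  · exact hb z h2
  have hC : 0 ≤ C := by simpa using Real.posLog_nonneg.trans (hg 0)
  set c : ℝ := Real.pi / (b - a) / 2 with hc
  have hba : 0 < b - a := sub_pos.mpr hab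
  have hc0 : 0 < c := by have := Real.pi_pos; positivity
  set D : ℝ := max |a| |b| with hD
  have hD0 : 0 ≤ D := (abs_nonneg a).trans (le_max_left _ _)
  refine PhragmenLindelof.vertical_strip hd.diffContOnCl
    ⟨c, half_lt_self (by have := Real.pi_pos; positivity),
      C * (n.factorial / c ^ n * Real.exp (c * (1 + D))), ?_⟩
    (fun z hz => ha z hz.le) (fun z hz => hb z hz.ge) h1 h2
  refine Asymptotics.IsBigO.of_bound 1 ?_
  filter_upwards [mem_inf_of_right (mem_principal_self _)] with z hz
  rw [one_mul, Real.norm_of_nonneg (Real.exp_pos _).le]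
  have hre : |z.re| ≤ D := by
    have h3 : a < z.re := hz.1
    have h4 : z.re < b := hz.2
    refine abs_le.mpr ⟨?_, ?_⟩
    · linarith [neg_abs_le a, le_max_left |a| |b|]
    · linarith [le_abs_self b, le_max_right |a| |b|]
  have hz1 : 1 + ‖z‖ ≤ 1 + D + |z.im| := by linarith [Complex.norm_le_abs_re_add_abs_im z]
  have hpow : (1 + ‖z‖) ^ n ≤
      n.factorial / c ^ n * Real.exp (c * (1 + D)) * Real.exp (c * |z.im|) := by
    have h3 := Real.pow_div_factorial_le_exp (c * (1 + D + |z.im|)) (by positivity) n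
    rw [mul_assoc, ← Real.exp_add, ← mul_add, div_mul_eq_mul_div, le_div_iff₀ (by positivity)]
    rw [div_le_iff₀ (by positivity), mul_pow] at h3
    calc (1 + ‖z‖) ^ n * c ^ n ≤ (1 + D + |z.im|) ^ n * c ^ n := by gcongr
      _ ≤ _ := by linarith
  have h5 : ‖h z‖ ≤ Real.exp (Real.posLog ‖h z‖) := by
    rcases (norm_nonneg (h z)).eq_or_lt with h0 | h0
    · rw [← h0]
      positivity
    · exact (Real.exp_log h0).symm.le.trans (Real.exp_le_exp.mpr (le_max_right _ _))
  refine h5.trans (Real.exp_le_exp.mpr ((hg z).trans ?_))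
  calc C * (1 + ‖z‖) ^ n
      ≤ C * (n.factorial / c ^ n * Real.exp (c * (1 + D)) * Real.exp (c * |z.im|)) := by gcongr
    _ = _ := by ring

theorem Differentiable.posLog_norm_le_of_circleAverage_le_sq {h : ℂ → ℂ} (hd : Differentiable ℂ h)
    {C : ℝ} (hC : ∀ ρ : ℝ, 2 ≤ ρ →
      Real.circleAverage (fun w => Real.posLog ‖h w‖) 0 ρ ≤ C * ρ ^ 2) (z : ℂ) :
    Real.posLog ‖h z‖ ≤ 4 * C * (1 + ‖z‖) ^ 4 := by
  have han : AnalyticOnNhd ℂ h Set.univ := fun w _ => hd.analyticAt w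
  have hm : Meromorphic h := fun w => (hd.analyticAt w).meromorphicAt
  have hchar : ∀ ρ : ℝ, ValueDistribution.characteristic h ⊤ ρ =
      Real.circleAverage (fun w => Real.posLog ‖h w‖) 0 ρ := by
    intro ρ
    rw [ValueDistribution.characteristic, Pi.add_apply, ValueDistribution.logCounting_top,
      negPart_eq_zero.mpr (MeromorphicOn.AnalyticOnNhd.divisor_nonneg han),
      ValueDistribution.proximity_top]
    simp
  have hC0 : 0 ≤ C := by
    have := (Real.circleAverage_nonneg_of_nonneg (f := fun w => Real.posLog ‖h w‖) (c := 0) (R := 2)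
      fun w _ => Real.posLog_nonneg).trans (hC 2 le_rfl)
    linarith
  refine (hd.posLog_norm_le_of_circleAverage_le z (M := C * (‖z‖ + 2) ^ 2) fun ρ hρ => ?_).trans ?_
  · have hz : (0 : ℝ) < ‖z‖ + 2 := by positivity
    rw [← hchar]
    refine (ValueDistribution.characteristic_monotoneOn hm (Set.mem_Ioi.mpr hρ.1)
      (Set.mem_Ioi.mpr hz) (by linarith [hρ.2])).trans ?_
    rw [hchar]
    exact hC _ (by linarith [norm_nonneg z])
  · have h1 : (‖z‖ + 2) ^ 2 ≤ (2 * (1 + ‖z‖)) ^ 2 := by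
      gcongr
      linarith [norm_nonneg z]
    calc (‖z‖ + 1) ^ 2 * (C * (‖z‖ + 2) ^ 2)
        ≤ (‖z‖ + 1) ^ 2 * (C * (2 * (1 + ‖z‖)) ^ 2) := by gcongr
      _ = _ := by ring

theorem Meromorphic.exists_differentiable_eq_nhdsNE {H : ℂ → ℂ} (hH : Meromorphic H)
    (ho : ∀ z, 0 ≤ meromorphicOrderAt H z) :
    ∃ h : ℂ → ℂ, Differentiable ℂ h ∧ ∀ z, h =ᶠ[𝓝[≠] z] H := by
  have hU : MeromorphicOn H Set.univ := fun z _ => hH z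
  refine ⟨toMeromorphicNFOn H Set.univ, fun z => ?_, fun z =>
    hU.toMeromorphicNFOn_eq_self_on_nhdsNE (Set.mem_univ z)⟩
  refine ((meromorphicNFOn_toMeromorphicNFOn H Set.univ
    (Set.mem_univ z)).meromorphicOrderAt_nonneg_iff_analyticAt.mp ?_).differentiableAt
  rw [meromorphicOrderAt_toMeromorphicNFOn hU (Set.mem_univ z)]
  exact ho z

theorem Filter.Tendsto.comap_re_atTop_of_eq_nhdsNE {H h : ℂ → ℂ} {l : ℂ}
    (hH : Tendsto H (comap Complex.re atTop) (𝓝 l)) (hc : Continuous h)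
    (he : ∀ z, h =ᶠ[𝓝[≠] z] H) : Tendsto h (comap Complex.re atTop) (𝓝 l) := by
  refine Metric.nhds_basis_closedBall.tendsto_right_iff.mpr fun ε hε => ?_
  obtain ⟨A, -, hA⟩ := (atTop_basis_Ioi.comap Complex.re).eventually_iff.mp
    (hH.eventually (Metric.closedBall_mem_nhds l hε))
  refine (atTop_basis_Ioi.comap Complex.re).eventually_iff.mpr ⟨A, trivial, fun s hs => ?_⟩
  have hopen : Complex.re ⁻¹' Set.Ioi A ∈ 𝓝 s :=
    (isOpen_Ioi.preimage Complex.continuous_re).mem_nhds hs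
  refine Metric.isClosed_closedBall.mem_of_tendsto
    ((hc.tendsto s).mono_left (nhdsWithin_le_nhds (s := {s}ᶜ))) ?_
  filter_upwards [he s, mem_nhdsWithin_of_mem_nhds hopen] with w hw hw'
  rw [hw]
  exact hA hw'

theorem codiscrete_of_forall_nhdsNE {p : ℂ → Prop} (h : ∀ z, ∀ᶠ w in 𝓝[≠] z, p w) :
    ∀ᶠ w in codiscrete ℂ, p w := by
  change {w | p w} ∈ codiscreteWithin Set.univ
  rw [mem_codiscreteWithin_iff_forall_mem_nhdsNE]
  intro z _
  exact mem_of_superset (h z) Set.subset_union_left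

theorem meromorphic_riemannZeta : Meromorphic riemannZeta := by
  intro z
  have h1 : (fun s => (completedRiemannZeta₀ s - 1 / s - 1 / (1 - s)) * (Gammaℝ s)⁻¹)
      =ᶠ[𝓝[≠] z] riemannZeta := by
    have h0 : ∀ᶠ s in 𝓝[≠] z, s ≠ 0 := by
      rcases eq_or_ne z 0 with rfl | hz
      · exact self_mem_nhdsWithin
      · exact nhdsWithin_le_nhds (isOpen_ne.mem_nhds hz)
    filter_upwards [h0] with s hs
    rw [riemannZeta_def_of_ne_zero hs, completedRiemannZeta_eq, ← div_eq_mul_inv]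
  refine MeromorphicAt.congr ?_ h1
  have h2 : MeromorphicAt completedRiemannZeta₀ z :=
    (differentiable_completedZeta₀.analyticAt z).meromorphicAt
  have h3 : MeromorphicAt (fun s => (Gammaℝ s)⁻¹) z :=
    (differentiable_Gammaℝ_inv.analyticAt z).meromorphicAt
  fun_prop

theorem riemannZeta_one_sub_eventuallyEq (z : ℂ) :
    ∀ᶠ s in 𝓝[≠] z, 2 * (2 * (Real.pi : ℂ)) ^ (-s) * Complex.cos ((Real.pi : ℂ) * s / 2) *
      Complex.Gamma s * riemannZeta s = riemannZeta (1 - s) := by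
  have h1 : ∀ᶠ s in 𝓝[≠] z, s ≠ 1 := by
    rcases eq_or_ne z 1 with rfl | hz
    · exact self_mem_nhdsWithin
    · exact nhdsWithin_le_nhds (isOpen_ne.mem_nhds hz)
  have h2 : ∀ᶠ s in 𝓝[≠] z, (Complex.Gamma s)⁻¹ ≠ 0 := by
    have h3 := AnalyticOnNhd.preimage_zero_mem_codiscrete (x := 1)
      (fun w _ => Complex.differentiable_one_div_Gamma.analyticAt w) (by simp)
    rw [codiscrete, mem_codiscreteWithin_iff_forall_mem_nhdsNE] at h3
    filter_upwards [h3 z (Set.mem_univ z)] with s hs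
    rcases hs with hs | hs
    · exact hs
    · exact absurd (Set.mem_univ s) hs
  filter_upwards [h1, h2] with s hs hs'
  rw [riemannZeta_one_sub (fun n hn => hs' (by rw [hn, Complex.Gamma_neg_nat_eq_zero, inv_zero])) hs]
  ring

theorem tendsto_one_sub_nhdsNE (z : ℂ) : Tendsto (fun s => 1 - s) (𝓝[≠] z) (𝓝[≠] (1 - z)) := by
  refine tendsto_nhdsWithin_iff.mpr ⟨((continuous_const.sub continuous_id).tendsto z).mono_left
    nhdsWithin_le_nhds, ?_⟩
  filter_upwards [self_mem_nhdsWithin] with s hs h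
  exact hs (sub_right_injective h)

theorem circleAverage_posLog_norm_le {f h : ℂ → ℂ} (hf : Meromorphic f) (hd : Differentiable ℂ h)
    (he : ∀ z, h =ᶠ[𝓝[≠] z] riemannZeta * f⁻¹) {A C T : ℝ}
    (hC : ∀ r, 1 ≤ r → ValueDistribution.characteristic f ⊤ r ≤ C * r ^ 2)
    (hA : ∀ z : ℂ, A < |z.re| → ‖h z‖ ≤ T) :
    ∃ C', ∀ ρ : ℝ, 2 ≤ ρ → Real.circleAverage (fun w => Real.posLog ‖h w‖) 0 ρ ≤ C' * ρ ^ 2 := by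
  obtain ⟨B, hB0, hB⟩ := norm_riemannZeta_le_exp A
  set E := max |Real.log ‖f 0‖| |Real.log ‖meromorphicTrailingCoeffAt f 0‖|
  have hE : 0 ≤ E := (abs_nonneg _).trans (le_max_left _ _)
  refine ⟨Real.posLog T + 2 * B + C + E, fun ρ hρ => ?_⟩
  set G : ℂ → ℝ := fun s => (Real.posLog T + B * (1 + ρ)) + Real.posLog ‖f⁻¹ s‖ with hG
  have hGint : CircleIntegrable (fun s => Real.posLog ‖f⁻¹ s‖) 0 ρ :=
    MeromorphicOn.circleIntegrable_posLog_norm fun s _ => (hf s).inv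
  have hhint : CircleIntegrable (fun s => Real.posLog ‖h s‖) 0 ρ :=
    MeromorphicOn.circleIntegrable_posLog_norm fun s _ => (hd.analyticAt s).meromorphicAt
  have hev : (fun s => Real.posLog ‖h s‖) =ᶠ[codiscreteWithin (Metric.sphere (0 : ℂ) |ρ|)]
      fun s => min (Real.posLog ‖h s‖) (G s) := by
    have hcod := (codiscrete_of_forall_nhdsNE he).filter_mono
      (codiscreteWithin_mono (Set.subset_univ (Metric.sphere (0 : ℂ) |ρ|)))
    filter_upwards [hcod, self_mem_codiscreteWithin _] with s hs hsρ
    have hsρ' : ‖s‖ = ρ := by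
      rwa [mem_sphere_zero_iff_norm, abs_of_nonneg (by linarith)] at hsρ
    refine (min_eq_left ?_).symm
    rcases lt_or_ge A |s.re| with h1 | h1
    · refine (Real.posLog_le_posLog (norm_nonneg _) (hA s h1)).trans ?_
      have h2 : 0 ≤ Real.posLog ‖f⁻¹ s‖ := Real.posLog_nonneg
      have h3 : 0 ≤ B * (1 + ρ) := by positivity
      simp only [hG]
      linarith
    · have h2 := hB s h1 (by linarith)
      rw [hsρ'] at h2
      have h3 : Real.posLog ‖riemannZeta s‖ ≤ B * (1 + ρ) := by
        refine (Real.posLog_le_posLog (norm_nonneg _) h2).trans ?_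
        rw [Real.posLog_apply, Real.log_exp]
        exact max_le (by positivity) le_rfl
      have h4 : Real.posLog ‖h s‖ ≤ Real.posLog ‖riemannZeta s‖ + Real.posLog ‖f⁻¹ s‖ := by
        rw [hs, Pi.mul_apply, norm_mul]
        exact Real.posLog_mul
      have h5 : 0 ≤ Real.posLog T := Real.posLog_nonneg
      simp only [hG]
      linarith
  rw [Real.circleAverage_congr_codiscreteWithin hev (by linarith)]
  refine (Real.circleAverage_mono (hhint.congr_codiscreteWithin hev)
    ((circleIntegrable_const _ _ _).add hGint) fun s _ => min_le_right _ _).trans ?_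
  rw [Real.circleAverage_add (circleIntegrable_const _ _ _) hGint,
    Real.circleAverage_const]
  have h1 : Real.circleAverage (fun s => Real.posLog ‖f⁻¹ s‖) 0 ρ ≤ C * ρ ^ 2 + E := by
    have h2 := ValueDistribution.characteristic_sub_characteristic_inv_le hf (R := ρ)
    have h3 := hC ρ (by linarith)
    have h4 : 0 ≤ ValueDistribution.logCounting f⁻¹ ⊤ ρ :=
      ValueDistribution.logCounting_nonneg (by linarith)
    have h5 : ValueDistribution.characteristic f⁻¹ ⊤ ρ =
        Real.circleAverage (fun s => Real.posLog ‖f⁻¹ s‖) 0 ρ +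
          ValueDistribution.logCounting f⁻¹ ⊤ ρ := by
      rw [ValueDistribution.characteristic, Pi.add_apply, ValueDistribution.proximity_top]
    linarith [(abs_le.mp h2).1]
  have h5 : 0 ≤ Real.posLog T := Real.posLog_nonneg
  have h6 : 1 ≤ ρ ^ 2 := by nlinarith
  have h7 : 1 + ρ ≤ 2 * ρ ^ 2 := by nlinarith
  have h8 := mul_le_mul_of_nonneg_left h7 hB0
  have h9 := mul_le_mul_of_nonneg_left h6 h5
  have h10 := mul_le_mul_of_nonneg_left h6 hE
  nlinarith

theorem eventuallyEq_riemannZeta_of_functional_equation {f : ℂ → ℂ} (hf : Meromorphic f)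
    (hne : ∀ z, meromorphicOrderAt f z ≠ ⊤)
    {C : ℝ} (hC : ∀ r, 1 ≤ r → ValueDistribution.characteristic f ⊤ r ≤ C * r ^ 2)
    (hlim : Tendsto f (comap Complex.re atTop) (𝓝 1))
    (hfe : ∀ z, (fun s => f (1 - s)) =ᶠ[𝓝[≠] z]
      (fun s => 2 * (2 * (Real.pi : ℂ)) ^ (-s) * Complex.cos ((Real.pi : ℂ) * s / 2) *
          Complex.Gamma s * f s))
    (hord : ∀ z, z ≠ 1 → meromorphicOrderAt f z ≤ meromorphicOrderAt riemannZeta z) (z : ℂ) :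
    f =ᶠ[𝓝[≠] z] riemannZeta := by
  have hnz : ∀ z, ∀ᶠ s in 𝓝[≠] z, f s ≠ 0 := fun z =>
    (meromorphicOrderAt_ne_top_iff_eventually_ne_zero (hf z)).mp (hne z)
  set H : ℂ → ℂ := riemannZeta * f⁻¹ with hH
  have hHm : Meromorphic H := fun z => (meromorphic_riemannZeta z).mul (hf z).inv
  have hsymm : ∀ z, H ∘ (fun s => 1 - s) =ᶠ[𝓝[≠] z] H := by
    intro z
    filter_upwards [hfe z, riemannZeta_one_sub_eventuallyEq z, hnz z,
      (tendsto_one_sub_nhdsNE z).eventually (hnz (1 - z))] with s h1 h2 h3 h4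
    simp only [hH, Function.comp_apply, Pi.mul_apply, Pi.inv_apply]
    rw [← h2]
    rw [h1] at h4 ⊢
    rw [← div_eq_mul_inv, ← div_eq_mul_inv, mul_div_mul_left _ _ (left_ne_zero_of_mul h4)]
  have ho1 : ∀ z, z ≠ 1 → 0 ≤ meromorphicOrderAt H z := by
    intro z hz
    rw [hH, meromorphicOrderAt_mul (meromorphic_riemannZeta z) (hf z).inv, meromorphicOrderAt_inv]
    have h1 := hord z hz
    obtain ⟨n, hn⟩ := WithTop.ne_top_iff_exists.mp (hne z)
    rw [← hn] at h1 ⊢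
    cases hk : meromorphicOrderAt riemannZeta z with
    | top => simp
    | coe k =>
      rw [hk] at h1
      have h2 : n ≤ k := by exact_mod_cast h1
      have h3 : (0 : WithTop ℤ) ≤ ((k + -n : ℤ) : WithTop ℤ) := by
        exact_mod_cast (by omega : 0 ≤ k + -n)
      exact_mod_cast h3
  have ho : ∀ z, 0 ≤ meromorphicOrderAt H z := by
    intro z
    rcases eq_or_ne z 1 with rfl | hz
    · have hda : AnalyticAt ℂ (fun s : ℂ => 1 - s) 1 := by fun_prop
      have hdd : deriv (fun s : ℂ => 1 - s) 1 ≠ 0 := by simp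
      rw [← meromorphicOrderAt_congr (hsymm 1), meromorphicOrderAt_comp_of_deriv_ne_zero hda hdd]
      exact ho1 _ (by simp)
    · exact ho1 z hz
  obtain ⟨h, hd, he⟩ := hHm.exists_differentiable_eq_nhdsNE ho
  have hhs : ∀ s, h (1 - s) = h s := by
    intro s
    have h1 : (fun w => h (1 - w)) =ᶠ[𝓝[≠] s] h := by
      filter_upwards [hsymm s, he s, (tendsto_one_sub_nhdsNE s).eventually (he (1 - s))]
        with w h1 h2 h3
      rw [h3, h2]
      exact h1
    have hc : Continuous fun w => h (1 - w) := hd.continuous.comp (by fun_prop)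
    exact ((hc.continuousAt.eventuallyEq_nhds_iff_eventuallyEq_nhdsNE
      hd.continuous.continuousAt).mp h1).eq_of_nhds
  have hHlim : Tendsto H (comap Complex.re atTop) (𝓝 1) := by
    have := tendsto_riemannZeta_comap_re_atTop.mul (hlim.inv₀ one_ne_zero)
    simpa using! this
  have hhlim := hHlim.comap_re_atTop_of_eq_nhdsNE hd.continuous he
  obtain ⟨A, -, hA⟩ := (atTop_basis_Ioi.comap Complex.re).eventually_iff.mp
    (hhlim.norm.eventually_le_const (u := 2) (by norm_num))
  have hA' : ∀ s : ℂ, |A| + 1 < |s.re| → ‖h s‖ ≤ 2 := by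
    intro s hs
    rcases lt_abs.mp hs with h1 | h1
    · exact hA (show A < s.re by linarith [le_abs_self A])
    · rw [← hhs]
      refine hA (show A < (1 - s).re from ?_)
      rw [Complex.sub_re, Complex.one_re]
      linarith [le_abs_self A]
  obtain ⟨C', hC'⟩ := circleAverage_posLog_norm_le hf hd he hC hA'
  have hconst := hd.apply_eq_apply_of_bounded_off_strip (a := -(|A| + 2)) (b := |A| + 2) (K := 2)
    (by linarith [abs_nonneg A]) (hd.posLog_norm_le_of_circleAverage_le_sq hC')
    (fun s hs => hA' s (lt_abs.mpr (Or.inr (by linarith))))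
    (fun s hs => hA' s (lt_abs.mpr (Or.inl (by linarith))))
  have hone : h z = 1 := by
    have hbot : (comap Complex.re atTop).NeBot :=
      atTop_neBot.comap_of_surj fun x => ⟨x, Complex.ofReal_re x⟩
    exact tendsto_nhds_unique tendsto_const_nhds (hhlim.congr fun s => hconst s z)
  filter_upwards [he z, hnz z] with s h1 h2
  rw [hconst s z, hone, hH, Pi.mul_apply, Pi.inv_apply] at h1
  field_simp at h1
  exact h1

theorem ZeroOfOrder.congr {f g : ℂ → ℂ} {z : ℂ} {m : ℕ} (hf : ZeroOfOrder f z m)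
    (h : f =ᶠ[𝓝[≠] z] g) : ZeroOfOrder g z m := by
  obtain ⟨k, hk, hk0, he⟩ := hf
  exact ⟨k, hk, hk0, by filter_upwards [h, he] with w h1 h2 using h1 ▸ h2⟩

theorem zeroOfOrder_iff_meromorphicOrderAt_eq {f : ℂ → ℂ} {z : ℂ} {m : ℕ}
    (hf : MeromorphicAt f z) : ZeroOfOrder f z m ↔ meromorphicOrderAt f z = (m : ℤ) := by
  rw [meromorphicOrderAt_eq_int_iff hf]
  simp only [ZeroOfOrder, zpow_natCast, smul_eq_mul]

/-- Let `f` be a nonconstant meromorphic function on `ℂ` of order at most `1` with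
`f(s) → 1` as `Re s → +∞` (uniformly in `Im s`). Then `f ≡ ζ` iff `f` satisfies the
Riemann functional equation and every zero of `f` is a zero of `ζ` with at least the
same multiplicity. -/
theorem uniqueness_of_zeta (f : ℂ → ℂ)
    (hmero : ∀ z : ℂ, MeromorphicAt f z)
    (hnc : ¬∃ c : ℂ, MeroEq f fun _ => c)
    (hord : OrderLeOne f)
    (hlim : Tendsto f (comap Complex.re atTop) (𝓝 1)) :
    MeroEq f riemannZeta ↔
      (MeroEq (fun s => f (1 - s))
        (fun s => 2 * (2 * (Real.pi : ℂ)) ^ (-s) * Complex.cos ((Real.pi : ℂ) * s / 2) *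
          Complex.Gamma s * f s) ∧
      ∀ (z : ℂ) (m : ℕ), 1 ≤ m → ZeroOfOrder f z m →
        ∃ k : ℕ, m ≤ k ∧ ZeroOfOrder riemannZeta z k) := by
  have hf : Meromorphic f := hmero
  constructor
  · intro h
    refine ⟨fun z => ?_, fun z m _ hm => ⟨m, le_rfl, hm.congr (h z)⟩⟩
    filter_upwards [riemannZeta_one_sub_eventuallyEq z, h z,
      (tendsto_one_sub_nhdsNE z).eventually (h (1 - z))] with s h1 h2 h3
    rw [h2, h3, h1]
  · rintro ⟨hfe, hzero⟩ z
    have hne : ∀ z, meromorphicOrderAt f z ≠ ⊤ := by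
      intro z hz
      refine hnc ⟨0, fun w => ?_⟩
      refine meromorphicOrderAt_eq_top_iff.mp ?_
      by_contra hw
      exact (MeromorphicOn.meromorphicOrderAt_ne_top_of_isPreconnected (U := Set.univ)
        (fun z _ => hf z) isPreconnected_univ (Set.mem_univ w) (Set.mem_univ z) hw) hz
    obtain ⟨C, -, hC⟩ := hord 1 one_pos
    refine eventuallyEq_riemannZeta_of_functional_equation hf hne (C := C) (fun r hr => ?_) hlim
      hfe (fun w hw => ?_) z
    · rw [← nevT_eq_characteristic hf (by linarith)]
      refine (hC r hr).trans_eq ?_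
      norm_num
    · obtain ⟨n, hn⟩ := WithTop.ne_top_iff_exists.mp (hne w)
      rw [← hn]
      rcases le_or_gt n 0 with h0 | h0
      · exact le_trans (by exact_mod_cast h0) (analyticOn_riemannZeta w hw).meromorphicOrderAt_nonneg
      · obtain ⟨m, rfl⟩ := Int.eq_ofNat_of_zero_le h0.le
        obtain ⟨k, hk, hzk⟩ := hzero w m (by omega)
          ((zeroOfOrder_iff_meromorphicOrderAt_eq (hf w)).mpr hn.symm)
        rw [(zeroOfOrder_iff_meromorphicOrderAt_eq (meromorphic_riemannZeta w)).mp hzk]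
        exact_mod_cast hk
end

section
/- The order hypothesis in the uniqueness theorem cannot be dropped: for L(s) = 1 + 2·4^{−s} and f(s) = L(s)/(1 + e^{s(1−s)}), the function 1 + e^{s(1−s)} is invariant under s ↦ 1 − s, hence f satisfies the same functional equation 2^s f(s) = 2^{1−s}·conj(f(1 − conj(s))) wherever defined; moreover for each fixed real t, f(σ + it) → 1 as σ → +∞; yet f is not identically equal to L. -/
open Complex Filter Topology

/-- `L(s) = 1 + 2·4^{-s}` (principal branch). -/
noncomputable def Lfun (s : ℂ) : ℂ := 1 + 2 * Complex.exp (-s * Real.log 4)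

/-- `f(s) = L(s)/(1 + e^{s(1-s)})`. -/
noncomputable def ffun (s : ℂ) : ℂ := Lfun s / (1 + Complex.exp (s * (1 - s)))

/-- `2^s` (principal branch). -/
noncomputable def twoPow (s : ℂ) : ℂ := Complex.exp (s * Real.log 2)

open ComplexConjugate

theorem Lfun_conj (s : ℂ) : Lfun (conj s) = conj (Lfun s) := by
  rw [Lfun, Lfun, map_add, map_mul, ← Complex.exp_conj, map_mul, map_neg, Complex.conj_ofReal,
    map_one, Complex.conj_ofNat]

theorem ffun_conj (s : ℂ) : ffun (conj s) = conj (ffun s) := by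
  simp [ffun, Lfun_conj, ← Complex.exp_conj]

theorem ffun_one_sub (s : ℂ) :
    ffun (1 - s) = Lfun (1 - s) / (1 + Complex.exp (s * (1 - s))) := by
  rw [ffun, sub_sub_cancel, mul_comm (1 - s)]

theorem twoPow_mul_Lfun (s : ℂ) : twoPow s * Lfun s = twoPow s + 2 * twoPow (-s) := by
  have hlog : Real.log 4 = 2 * Real.log 2 := by
    rw [show (4 : ℝ) = 2 ^ 2 by norm_num, Real.log_pow]; norm_num
  have hexp : Complex.exp (s * Real.log 2) * Complex.exp (-s * Real.log 4) =
      Complex.exp (-s * Real.log 2) := by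
    rw [← Complex.exp_add, hlog]
    push_cast
    ring_nf
  rw [Lfun, twoPow, twoPow]
  linear_combination 2 * hexp

theorem twoPow_one_add (s : ℂ) : twoPow (1 + s) = 2 * twoPow s := by
  have h : Complex.exp (Real.log 2) = 2 := by
    rw [← Complex.ofReal_exp, Real.exp_log two_pos]; norm_num
  rw [twoPow, twoPow, add_mul, Complex.exp_add, one_mul, h]

theorem twoPow_mul_Lfun_one_sub (s : ℂ) :
    twoPow (1 - s) * Lfun (1 - s) = twoPow s * Lfun s := by
  have h := twoPow_one_add (-(1 - s))
  rw [show 1 + -(1 - s) = s by ring] at h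
  rw [twoPow_mul_Lfun, twoPow_mul_Lfun, ← h, sub_eq_add_neg, twoPow_one_add]
  ring

theorem tendsto_Lfun_atTop (t : ℝ) :
    Tendsto (fun σ : ℝ => Lfun (σ + t * Complex.I)) atTop (𝓝 1) := by
  have hlog : 0 < Real.log 4 := Real.log_pos (by norm_num)
  have h : Tendsto (fun σ : ℝ => Complex.exp (-(σ + t * Complex.I) * Real.log 4)) atTop (𝓝 0) := by
    rw [Complex.tendsto_exp_nhds_zero_iff]
    have hre (σ : ℝ) : (-(σ + t * Complex.I) * Real.log 4).re = -(σ * Real.log 4) := by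
      rw [Complex.re_mul_ofReal]; simp
    simp only [hre]
    exact tendsto_neg_atTop_atBot.comp (tendsto_id.atTop_mul_const hlog)
  simpa [Lfun] using (h.const_mul 2).const_add 1

theorem tendsto_exp_mul_one_sub_atTop (t : ℝ) :
    Tendsto (fun σ : ℝ => Complex.exp ((σ + t * Complex.I) * (1 - (σ + t * Complex.I))))
      atTop (𝓝 0) := by
  rw [Complex.tendsto_exp_nhds_zero_iff]
  have hre (σ : ℝ) :
      ((σ + t * Complex.I) * (1 - (σ + t * Complex.I))).re = σ * (1 - σ) + t ^ 2 := by
    simp; ring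
  simp only [hre]
  refine tendsto_atBot_add_const_right _ _ (tendsto_id.atTop_mul_atBot₀ ?_)
  exact tendsto_atBot_add_const_left _ 1 tendsto_neg_atTop_atBot

theorem tendsto_ffun_atTop (t : ℝ) :
    Tendsto (fun σ : ℝ => ffun (σ + t * Complex.I)) atTop (𝓝 1) := by
  simpa [ffun, Pi.div_def] using
    (tendsto_Lfun_atTop t).div ((tendsto_exp_mul_one_sub_atTop t).const_add 1) (by simp)

theorem continuous_Lfun : Continuous Lfun := by
  unfold Lfun
  fun_prop

theorem continuousAt_ffun {s : ℂ} (hs : 1 + Complex.exp (s * (1 - s)) ≠ 0) :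
    ContinuousAt ffun s :=
  continuous_Lfun.continuousAt.div (by fun_prop) hs

theorem not_meroEq_ffun_Lfun : ¬ MeroEq ffun Lfun := by
  intro h
  have hf : ContinuousAt ffun 0 := continuousAt_ffun (by norm_num)
  have heq : ffun 0 = Lfun 0 :=
    tendsto_nhds_unique_of_eventuallyEq (hf.tendsto.mono_left nhdsWithin_le_nhds)
      (continuous_Lfun.continuousAt.tendsto.mono_left nhdsWithin_le_nhds) (h 0)
  norm_num [ffun, Lfun] at heq

/-- The order hypothesis cannot be dropped: for `L(s) = 1 + 2·4^{-s}` and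
`f(s) = L(s)/(1 + e^{s(1-s)})`, the function `1 + e^{s(1-s)}` is invariant under
`s ↦ 1 - s`, hence `f` satisfies the functional equation
`2^s f(s) = 2^{1-s} conj (f(1 - conj s))` wherever defined; for each fixed real `t`,
`f(σ + it) → 1` as `σ → +∞`; yet `f ≢ L`. -/
theorem order_hypothesis_cannot_be_dropped :
    (∀ s : ℂ, 1 + Complex.exp ((1 - s) * (1 - (1 - s))) = 1 + Complex.exp (s * (1 - s))) ∧
    (∀ s : ℂ, 1 + Complex.exp (s * (1 - s)) ≠ 0 →
      twoPow s * ffun s =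
        twoPow (1 - s) * (starRingEnd ℂ) (ffun (1 - (starRingEnd ℂ) s))) ∧
    (∀ t : ℝ, Tendsto (fun σ : ℝ => ffun (σ + t * Complex.I)) atTop (𝓝 1)) ∧
    ¬ MeroEq ffun Lfun := by
  refine ⟨fun s => by rw [sub_sub_cancel, mul_comm], fun s _ => ?_, tendsto_ffun_atTop,
    not_meroEq_ffun_Lfun⟩
  rw [← ffun_conj, map_sub, map_one, Complex.conj_conj, ffun_one_sub, ffun,
    ← mul_div_assoc, ← mul_div_assoc, twoPow_mul_Lfun_one_sub]
end

section
/- Let (ρ_k)_{k≥1} be a sequence of nonzero complex numbers and let n(r) denote the number of indices k with |ρ_k| ≤ r. Suppose limsup_{r→∞} n(r)/r < D₁·(log 4)/π for some 0 < D₁ < 1, and let D₁ < D₂ < 1. Then the product P(s) = ∏_{k=1}^∞ (1 − s²/ρ_k²) converges locally uniformly to an entire function, and for all s with |s| sufficiently large, log|P(s)| ≤ D₂·|s|·log 4; in particular P has order at most 1. -/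
open Complex Filter Topology

/-- The partial products of Euler's product for `sinh (π y) / (π y)` are at most `exp (π y)`. -/
lemma prod_one_add_sq_div_le_exp {y : ℝ} (hy : 0 ≤ y) (n : ℕ) :
    ∏ j ∈ Finset.range n, (1 + y ^ 2 / ((j : ℝ) + 1) ^ 2) ≤ Real.exp (Real.pi * y) := by
  rcases hy.eq_or_lt with rfl | hy
  · simp
  have hπy : 0 < Real.pi * y := by positivity
  have hlim := (Complex.tendsto_euler_sin_prod (y * I)).norm
  have hsin : ‖Complex.sin (Real.pi * (y * I))‖ = Real.sinh (Real.pi * y) := by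
    rw [← mul_assoc, Complex.sin_mul_I, norm_mul, Complex.norm_I, mul_one, ← Complex.ofReal_mul,
      ← Complex.ofReal_sinh, Complex.norm_real, Real.norm_eq_abs,
      abs_of_pos (Real.sinh_pos_iff.2 hπy)]
  have hprod (m : ℕ) : ‖(Real.pi : ℂ) * (y * I) *
      ∏ j ∈ Finset.range m, (1 - (y * I) ^ 2 / ((j : ℂ) + 1) ^ 2)‖ =
      Real.pi * y * ∏ j ∈ Finset.range m, (1 + y ^ 2 / ((j : ℝ) + 1) ^ 2) := by
    have hcast : ∏ j ∈ Finset.range m, (1 - (y * I) ^ 2 / ((j : ℂ) + 1) ^ 2) =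
        ((∏ j ∈ Finset.range m, (1 + y ^ 2 / ((j : ℝ) + 1) ^ 2) : ℝ) : ℂ) := by
      push_cast
      refine Finset.prod_congr rfl fun j _ => ?_
      rw [mul_pow, I_sq]
      ring
    have hnonneg : 0 ≤ ∏ j ∈ Finset.range m, (1 + y ^ 2 / ((j : ℝ) + 1) ^ 2) :=
      Finset.prod_nonneg fun j _ => by positivity
    rw [hcast, ← mul_assoc, norm_mul, norm_mul, Complex.norm_I, mul_one, ← Complex.ofReal_mul,
      Complex.norm_real, Complex.norm_real, Real.norm_of_nonneg hπy.le, Real.norm_of_nonneg hnonneg]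
  simp only [hprod, hsin] at hlim
  have hmono : Monotone fun m : ℕ =>
      Real.pi * y * ∏ j ∈ Finset.range m, (1 + y ^ 2 / ((j : ℝ) + 1) ^ 2) := by
    refine monotone_nat_of_le_succ fun m => mul_le_mul_of_nonneg_left ?_ hπy.le
    rw [Finset.prod_range_succ]
    refine le_mul_of_one_le_right (Finset.prod_nonneg fun j _ => by positivity) ?_
    exact le_add_of_nonneg_right (by positivity)
  have hle := hmono.ge_of_tendsto hlim n
  have hsinh : Real.sinh (Real.pi * y) ≤ Real.pi * y * Real.exp (Real.pi * y) := by
    have h1 := Real.add_one_le_exp (-(2 * (Real.pi * y)))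
    have h2 : Real.exp (-(Real.pi * y)) =
        Real.exp (Real.pi * y) * Real.exp (-(2 * (Real.pi * y))) := by
      rw [← Real.exp_add]
      ring_nf
    rw [Real.sinh_eq, h2]
    nlinarith [Real.exp_pos (Real.pi * y)]
  exact le_of_mul_le_mul_left (hle.trans hsinh) hπy

/-- If the counting function of positive numbers `a k` is at most `c * r` for `r ≥ r₀`, then the
product of `1 + x ^ 2 / a k ^ 2` over indices with `r₀ ≤ a k` is dominated by the product for the
arithmetic progression `(j + 1) / c`. -/
lemma prod_one_add_sq_div_le_of_card_le {ι : Type*} {a : ι → ℝ} {c r₀ : ℝ} (ha : ∀ k, 0 < a k)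
    (hfin : ∀ r : ℝ, {k | a k ≤ r}.Finite)
    (hcount : ∀ r : ℝ, r₀ ≤ r → (Nat.card {k | a k ≤ r} : ℝ) ≤ c * r) (x : ℝ)
    (S : Finset ι) (hS : ∀ k ∈ S, r₀ ≤ a k) :
    ∏ k ∈ S, (1 + x ^ 2 / a k ^ 2) ≤
      ∏ j ∈ Finset.range S.card, (1 + (c * x) ^ 2 / ((j : ℝ) + 1) ^ 2) := by
  classical
  induction S using Finset.induction_on_max_value a with
  | empty => simp
  | insert k S hk hmax ih =>
    rw [Finset.prod_insert hk, Finset.card_insert_of_notMem hk, Finset.prod_range_succ, mul_comm]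
    refine mul_le_mul (ih fun i hi => hS i (Finset.mem_insert_of_mem hi)) ?_
      (by positivity) (Finset.prod_nonneg fun j _ => by positivity)
    have hcard : (S.card : ℝ) + 1 ≤ c * a k := by
      refine le_trans ?_ (hcount (a k) (hS k (Finset.mem_insert_self k S)))
      have hsub : ((insert k S : Finset ι) : Set ι) ⊆ {i | a i ≤ a k} := by
        intro i hi
        rcases Finset.mem_insert.1 (Finset.mem_coe.1 hi) with rfl | hi
        · exact le_refl (a i)
        · exact hmax i hi
      have h := Set.ncard_le_ncard hsub (hfin (a k))
      rw [Set.ncard_coe_finset, Finset.card_insert_of_notMem hk] at h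
      exact_mod_cast h
    have hak := ha k
    gcongr 1 + ?_
    rw [div_le_div_iff₀ (by positivity) (by positivity)]
    have hsq : ((S.card : ℝ) + 1) ^ 2 ≤ (c * a k) ^ 2 := by gcongr
    nlinarith [mul_le_mul_of_nonneg_left hsq (sq_nonneg x)]

lemma one_add_sq_le_exp_sqrt {u : ℝ} (hu : 0 ≤ u) : 1 + u ^ 2 ≤ Real.exp (4 * √u) := by
  have hs := Real.sqrt_nonneg u
  have hsq := Real.sq_sqrt hu
  have h1 := Real.add_one_le_exp (√u)
  calc 1 + u ^ 2 = 1 + √u ^ 4 := by rw [← hsq]; ring_nf; rw [Real.sqrt_sq hs]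
    _ ≤ (√u + 1) ^ 4 := by
      have : (√u + 1) ^ 4 = 1 + √u ^ 4 + (4 * √u + 6 * √u ^ 2 + 4 * √u ^ 3) := by ring
      rw [this]
      exact le_add_of_nonneg_right (by positivity)
    _ ≤ Real.exp (√u) ^ 4 := by gcongr
    _ = Real.exp (4 * √u) := by rw [← Real.exp_nat_mul]; norm_num

/-- A linear bound on the counting function gives a growth bound on all finite products, uniform in
the set of indices. -/
lemma exists_prod_one_add_sq_div_le_exp {ι : Type*} {a : ι → ℝ} {c r₀ : ℝ} (hc : 0 ≤ c)
    (ha : ∀ k, 0 < a k) (hfin : ∀ r : ℝ, {k | a k ≤ r}.Finite)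
    (hcount : ∀ r : ℝ, r₀ ≤ r → (Nat.card {k | a k ≤ r} : ℝ) ≤ c * r) :
    ∃ K : ℝ, 0 ≤ K ∧ ∀ (S : Finset ι) (x : ℝ), 0 ≤ x →
      ∏ k ∈ S, (1 + x ^ 2 / a k ^ 2) ≤ Real.exp (K * √x + Real.pi * c * x) := by
  classical
  set F : Finset ι := (hfin r₀).toFinset
  refine ⟨∑ k ∈ F, 4 / √(a k), Finset.sum_nonneg fun k _ => by positivity, fun S x hx => ?_⟩
  rw [← Finset.prod_filter_mul_prod_filter_not S (· ∈ F), Real.exp_add]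
  refine mul_le_mul ?_ ?_ (Finset.prod_nonneg fun k _ => by positivity) (Real.exp_pos _).le
  · rw [Finset.sum_mul, Real.exp_sum]
    calc ∏ k ∈ S with k ∈ F, (1 + x ^ 2 / a k ^ 2) ≤ ∏ k ∈ F, (1 + x ^ 2 / a k ^ 2) := by
          refine Finset.prod_le_prod_of_subset_of_one_le
            (fun k hk => (Finset.mem_filter.1 hk).2) (fun k _ => by positivity)
            fun k _ _ => le_add_of_nonneg_right (by positivity)
      _ ≤ _ := by
          refine Finset.prod_le_prod (fun k _ => by positivity) fun k _ => ?_
          have h := one_add_sq_le_exp_sqrt (div_nonneg hx (ha k).le)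
          rwa [div_pow, Real.sqrt_div hx, mul_div_assoc', ← div_mul_eq_mul_div] at h
  · refine (prod_one_add_sq_div_le_of_card_le ha hfin hcount x _ fun k hk => ?_).trans ?_
    · have h := (Finset.mem_filter.1 hk).2
      simp only [F, Set.Finite.mem_toFinset, Set.mem_ofPred_eq, not_le] at h
      exact h.le
    · rw [mul_assoc]
      exact prod_one_add_sq_div_le_exp (by positivity) _

lemma one_add_sum_le_prod_one_add {ι : Type*} (S : Finset ι) {f : ι → ℝ} (hf : ∀ k, 0 ≤ f k) :
    1 + ∑ k ∈ S, f k ≤ ∏ k ∈ S, (1 + f k) := by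
  classical
  induction S using Finset.induction_on with
  | empty => simp
  | insert k S hk ih =>
    rw [Finset.sum_insert hk, Finset.prod_insert hk]
    nlinarith [hf k, mul_le_mul_of_nonneg_left ih (hf k),
      mul_nonneg (hf k) (Finset.sum_nonneg fun i (_ : i ∈ S) => hf i)]

/-- Let `(ρ_k)` be nonzero complex numbers whose counting function `n(r)` is finite for
each `r` and eventually satisfies `n(r) < D₁ (log 4 / π) r` with `0 < D₁ < 1`
(i.e. `limsup n(r)/r < D₁ (log 4)/π`), and let `D₁ < D₂ < 1`. Then
`P(s) = ∏_k (1 - s²/ρ_k²)` converges locally uniformly to an entire function,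
`log |P(s)| ≤ D₂ |s| log 4` for all `|s|` large, and `P` has order at most `1`. -/
theorem product_growth_estimate (ρ : ℕ → ℂ) (hρ : ∀ k, ρ k ≠ 0)
    (hfin : ∀ r : ℝ, {k : ℕ | ‖ρ k‖ ≤ r}.Finite)
    (D₁ D₂ : ℝ) (hD₁ : 0 < D₁) (hD₁' : D₁ < 1) (h₁₂ : D₁ < D₂) (hD₂ : D₂ < 1)
    (r₀ : ℝ) (hr₀ : 0 < r₀)
    (hcount : ∀ r : ℝ, r₀ ≤ r →
      (Nat.card {k : ℕ | ‖ρ k‖ ≤ r} : ℝ) < D₁ * (Real.log 4 / Real.pi) * r) :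
    (∀ s : ℂ, Multipliable fun k : ℕ => 1 - s ^ 2 / ρ k ^ 2) ∧
    TendstoLocallyUniformly
      (fun (N : Finset ℕ) (s : ℂ) => ∏ k ∈ N, (1 - s ^ 2 / ρ k ^ 2))
      (fun s : ℂ => ∏' k : ℕ, (1 - s ^ 2 / ρ k ^ 2)) atTop ∧
    Differentiable ℂ (fun s : ℂ => ∏' k : ℕ, (1 - s ^ 2 / ρ k ^ 2)) ∧
    (∃ R : ℝ, ∀ s : ℂ, R ≤ ‖s‖ →
      Real.log ‖∏' k : ℕ, (1 - s ^ 2 / ρ k ^ 2)‖ ≤ D₂ * ‖s‖ * Real.log 4) ∧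
    (∀ ε : ℝ, 0 < ε → ∃ C : ℝ, 0 < C ∧ ∀ s : ℂ, 1 ≤ ‖s‖ →
      Real.log ‖∏' k : ℕ, (1 - s ^ 2 / ρ k ^ 2)‖ ≤ C * ‖s‖ ^ (1 + ε)) := by
  have hlog4 : 0 < Real.log 4 := Real.log_pos (by norm_num)
  have hpos (k : ℕ) : 0 < ‖ρ k‖ := norm_pos_iff.2 (hρ k)
  obtain ⟨K, hK, hbound⟩ := exists_prod_one_add_sq_div_le_exp (a := fun k => ‖ρ k‖)
    (c := D₁ * (Real.log 4 / Real.pi)) (by positivity) hpos hfin fun r hr => (hcount r hr).le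
  have hrate : Real.pi * (D₁ * (Real.log 4 / Real.pi)) = D₁ * Real.log 4 := by
    field_simp
  rw [hrate] at hbound
  have hsum : Summable fun k => 1 / ‖ρ k‖ ^ 2 := by
    refine summable_of_sum_le (c := Real.exp (K * √1 + D₁ * Real.log 4 * 1))
      (fun k => by positivity) fun S => ?_
    have h1 := one_add_sum_le_prod_one_add S (f := fun k => 1 / ‖ρ k‖ ^ 2) fun k => by positivity
    have h2 := hbound S 1 zero_le_one
    rw [one_pow] at h2
    linarith
  have hloc : TendstoLocallyUniformly
      (fun (N : Finset ℕ) (s : ℂ) => ∏ k ∈ N, (1 - s ^ 2 / ρ k ^ 2))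
      (fun s : ℂ => ∏' k : ℕ, (1 - s ^ 2 / ρ k ^ 2)) atTop := by
    rw [tendstoLocallyUniformly_iff_forall_isCompact]
    intro L hL
    obtain ⟨M, hM⟩ := hL.isBounded.exists_norm_le
    have h := Summable.hasProdUniformlyOn_one_add (f := fun k s => -(s ^ 2 / ρ k ^ 2)) hL
      (hsum.mul_left (M ^ 2)) (Eventually.of_forall fun k s hs => ?_) fun k => by fun_prop
    · simpa only [← sub_eq_add_neg] using h.tendstoUniformlyOn
    · rw [norm_neg, norm_div, norm_pow, norm_pow, mul_one_div]
      gcongr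
      exact hM s hs
  have hprod (s : ℂ) : Tendsto (fun N : Finset ℕ => ∏ k ∈ N, (1 - s ^ 2 / ρ k ^ 2)) atTop
      (𝓝 (∏' k : ℕ, (1 - s ^ 2 / ρ k ^ 2))) :=
    (tendstoLocallyUniformlyOn_univ.2 hloc).tendsto_at (Set.mem_univ s)
  have hlog (s : ℂ) : Real.log ‖∏' k : ℕ, (1 - s ^ 2 / ρ k ^ 2)‖ ≤
      K * √‖s‖ + D₁ * Real.log 4 * ‖s‖ := by
    have hexp : ‖∏' k : ℕ, (1 - s ^ 2 / ρ k ^ 2)‖ ≤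
        Real.exp (K * √‖s‖ + D₁ * Real.log 4 * ‖s‖) := by
      refine le_of_tendsto' (hprod s).norm fun N => le_trans ?_ (hbound N ‖s‖ (norm_nonneg s))
      rw [norm_prod]
      refine Finset.prod_le_prod (fun k _ => norm_nonneg _) fun k _ => ?_
      refine (norm_sub_le _ _).trans_eq ?_
      rw [norm_one, norm_div, norm_pow, norm_pow]
    rcases (norm_nonneg (∏' k : ℕ, (1 - s ^ 2 / ρ k ^ 2))).eq_or_lt with h0 | h0
    · rw [← h0, Real.log_zero]
      positivity
    · exact (Real.log_le_iff_le_exp h0).2 hexp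
  refine ⟨fun s => ⟨_, hprod s⟩, hloc, ?_, ?_, fun ε hε => ?_⟩
  · refine differentiableOn_univ.1 <| (tendstoLocallyUniformlyOn_univ.2 hloc).differentiableOn
      (Eventually.of_forall fun N => ?_) isOpen_univ
    fun_prop
  · set δ := (D₂ - D₁) * Real.log 4
    have hδ : 0 < δ := mul_pos (sub_pos.2 h₁₂) hlog4
    refine ⟨(K / δ) ^ 2, fun s hs => (hlog s).trans ?_⟩
    have h1 : K ≤ δ * √‖s‖ := by
      rw [mul_comm, ← div_le_iff₀ hδ]
      exact Real.le_sqrt_of_sq_le hs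
    have h2 : K * √‖s‖ ≤ δ * ‖s‖ := by
      calc K * √‖s‖ ≤ δ * √‖s‖ * √‖s‖ := by gcongr
        _ = δ * ‖s‖ := by rw [mul_assoc, Real.mul_self_sqrt (norm_nonneg s)]
    calc K * √‖s‖ + D₁ * Real.log 4 * ‖s‖ ≤ δ * ‖s‖ + D₁ * Real.log 4 * ‖s‖ := by gcongr
      _ = D₂ * ‖s‖ * Real.log 4 := by simp only [δ]; ring
  · refine ⟨K + D₁ * Real.log 4, by positivity, fun s hs => (hlog s).trans ?_⟩
    have h1 : √‖s‖ ≤ ‖s‖ := (Real.sqrt_le_left (norm_nonneg _)).2 (le_self_pow₀ hs two_ne_zero)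
    have h2 : ‖s‖ ≤ ‖s‖ ^ (1 + ε) := Real.self_le_rpow_of_one_le hs (by linarith)
    calc K * √‖s‖ + D₁ * Real.log 4 * ‖s‖ ≤ K * ‖s‖ + D₁ * Real.log 4 * ‖s‖ := by gcongr
      _ = (K + D₁ * Real.log 4) * ‖s‖ := by ring
      _ ≤ _ := by gcongr
end
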